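/- In the discrete setup, let λ : ℝ^k → ℝ be a function such that λ(α) is an eigenvalue of H^α for every α ∈ ℝ^k, let α* ∈ ℝ^k be a critical point of λ (λ is differentiable at α* and its total derivative there is zero), and suppose the eigenvalue λ(α*) of H^{α*} is simple (its eigenspace over ℂ is one-dimensional). Then any eigenvector f : V → ℂ of H^{α*} corresponding to λ(α*) satisfies e^{iα*_j}·f(u_j)·conj(f(v_j)) ∈ ℝ for every j = 1,…,k. -/

import Mathlib

open Matrix Complex BigOperators

/-- The magnetic hopping matrix `M^α`: its only nonzero entries are
`M^α_{v_j, u_j} = e^{i α_j}` and `M^α_{u_j, v_j} = e^{-i α_j}`. -/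
noncomputable def magM {V : Type*} [Fintype V] [DecidableEq V] {k : ℕ}
    (v u : Fin k → V) (α : Fin k → ℝ) : Matrix V V ℂ := fun x y =>
  (∑ j, if x = v j ∧ y = u j then Complex.exp (Complex.I * α j) else 0) +
  (∑ j, if x = u j ∧ y = v j then Complex.exp (-(Complex.I * α j)) else 0)

/-- The magnetic discrete Schrödinger operator `H^α = Q - C - M^α` on the fundamental
domain: `Q` is the diagonal potential, `C` the adjacency matrix of `G`. -/
noncomputable def magH {V : Type*} [Fintype V] [DecidableEq V]
    (G : SimpleGraph V) [DecidableRel G.Adj] (q : V → ℝ) {k : ℕ}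
    (v u : Fin k → V) (α : Fin k → ℝ) : Matrix V V ℂ :=
  Matrix.diagonal (fun x => (q x : ℂ)) - G.adjMatrix ℂ - magM v u α

/-- The diagonal matrix `M^γ`: its only nonzero entries are `M^γ_{v_j,v_j} = γ_j` and
`M^γ_{u_j,u_j} = γ_j⁻¹`. -/
noncomputable def robM {V : Type*} [Fintype V] [DecidableEq V] {k : ℕ}
    (v u : Fin k → V) (γ : Fin k → ℂ) : Matrix V V ℂ :=
  Matrix.diagonal (fun x =>
    (∑ j, if x = v j then γ j else 0) + (∑ j, if x = u j then (γ j)⁻¹ else 0))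

/-- The operator `H^γ = Q - C - M^γ`. -/
noncomputable def robH {V : Type*} [Fintype V] [DecidableEq V]
    (G : SimpleGraph V) [DecidableRel G.Adj] (q : V → ℝ) {k : ℕ}
    (v u : Fin k → V) (γ : Fin k → ℂ) : Matrix V V ℂ :=
  Matrix.diagonal (fun x => (q x : ℂ)) - G.adjMatrix ℂ - robM v u γ

lemma magM_form {V : Type*} [Fintype V] [DecidableEq V] {k : ℕ}
    (v u : Fin k → V) (α : Fin k → ℝ) (f g : V → ℂ) :
    star f ⬝ᵥ (magM v u α *ᵥ g) =
      ∑ j, (Complex.exp (Complex.I * α j) * g (u j) * star (f (v j)) +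
        Complex.exp (-(Complex.I * α j)) * g (v j) * star (f (u j))) := by
  have h : ∀ (a b : Fin k → V) (e : Fin k → ℂ),
      ∑ x, star (f x) * ∑ y, (∑ j, if x = a j ∧ y = b j then e j else 0) * g y
        = ∑ j, e j * g (b j) * star (f (a j)) := by
    intro a b e
    simp only [Finset.sum_mul, Finset.mul_sum]
    have : ∀ x, ∑ y, ∑ j, star (f x) * ((if x = a j ∧ y = b j then e j else 0) * g y)
        = ∑ j, ∑ y, star (f x) * ((if x = a j ∧ y = b j then e j else 0) * g y) :=
      fun x => Finset.sum_comm
    simp only [this]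
    rw [Finset.sum_comm]
    refine Finset.sum_congr rfl fun j _ => ?_
    rw [Finset.sum_eq_single (a j), Finset.sum_eq_single (b j)]
    · simp; ring
    · intro y _ hy; simp [hy]
    · simp
    · intro x _ hx; simp [hx]
    · simp
  rw [Finset.sum_add_distrib, ← h, ← h, ← Finset.sum_add_distrib]
  simp only [dotProduct, mulVec, magM, Pi.star_apply, add_mul, Finset.sum_add_distrib, mul_add]

lemma magH_herm {V : Type*} [Fintype V] [DecidableEq V]
    (G : SimpleGraph V) [DecidableRel G.Adj] (q : V → ℝ) {k : ℕ}
    (v u : Fin k → V) (α : Fin k → ℝ) : (magH G q v u α).IsHermitian := by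
  have h1 : (Matrix.diagonal (fun x => (q x : ℂ))).IsHermitian := by
    rw [Matrix.IsHermitian, Matrix.diagonal_conjTranspose]
    congr 1; ext x; simp
  have h2 : (G.adjMatrix ℂ).IsHermitian := by
    ext x y
    simp [Matrix.conjTranspose_apply, SimpleGraph.adjMatrix_apply, G.adj_comm, apply_ite]
  have h3 : (magM v u α).IsHermitian := by
    ext x y
    simp only [Matrix.conjTranspose_apply, magM, star_add, star_sum]
    rw [add_comm]
    congr 1 <;> refine Finset.sum_congr rfl fun j _ => ?_
    · simp only [and_comm (a := y = _)]
      split_ifs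
      · simp [← Complex.exp_conj]
      · simp
    · simp only [and_comm (a := y = _)]
      split_ifs
      · simp [← Complex.exp_conj]
      · simp
  exact (h1.sub h2).sub h3

lemma magH_cont {V : Type*} [Fintype V] [DecidableEq V]
    (G : SimpleGraph V) [DecidableRel G.Adj] (q : V → ℝ) {k : ℕ}
    (v u : Fin k → V) : Continuous (fun α => magH G q v u α) := by
  refine continuous_matrix fun x y => ?_
  simp only [magH, magM, Matrix.sub_apply]
  refine continuous_const.sub (Continuous.add ?_ ?_) <;>
  · refine continuous_finsetSum _ fun j _ => ?_
    split_ifs <;> fun_prop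

/-- **Lemma A.2 (discrete reality condition).** If `α*` is a critical point of the
dispersion-relation branch `λ` and the eigenvalue `λ(α*)` of `H^{α*}` is simple, then any
corresponding eigenvector `f` satisfies `e^{iα*_j} f(u_j) conj (f(v_j)) ∈ ℝ` for all `j`. -/
theorem critical_point_reality_discrete
    {V : Type*} [Fintype V] [DecidableEq V]
    (G : SimpleGraph V) [DecidableRel G.Adj] (q : V → ℝ) {k : ℕ}
    (v u : Fin k → V)
    (hdist : Function.Injective (Sum.elim v u : Fin k ⊕ Fin k → V))
    (hnoedge : ∀ j, ¬ G.Adj (v j) (u j))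
    (lam : (Fin k → ℝ) → ℝ)
    (hlam : ∀ α, Module.End.HasEigenvalue (magH G q v u α).mulVecLin (lam α : ℂ))
    (αs : Fin k → ℝ)
    (hdiff : DifferentiableAt ℝ lam αs)
    (hcrit : fderiv ℝ lam αs = 0)
    (hsimple : Module.finrank ℂ
      (Module.End.eigenspace (magH G q v u αs).mulVecLin (lam αs : ℂ)) = 1)
    (f : V → ℂ) (hf0 : f ≠ 0)
    (hf : (magH G q v u αs).mulVec f = (lam αs : ℂ) • f) :
    ∀ j, (Complex.exp (Complex.I * αs j) * f (u j) * (starRingEnd ℂ) (f (v j))).im = 0 := by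
  intro j
  -- the perturbed parameters
  set e : Fin k → ℝ := Pi.single j 1 with he
  set t : ℕ → ℝ := fun n => 1 / ((n : ℝ) + 1) with ht
  have htpos : ∀ n, t n ≠ 0 := fun n => by
    have : (0 : ℝ) < 1 / ((n : ℝ) + 1) := by positivity
    exact this.ne'
  have ht0 : Filter.Tendsto t Filter.atTop (nhds 0) := tendsto_one_div_add_atTop_nhds_zero_nat
  set a : ℕ → (Fin k → ℝ) := fun n => αs + t n • e with ha
  have ha0 : Filter.Tendsto a Filter.atTop (nhds αs) := by
    have : Filter.Tendsto (fun n => αs + t n • e) Filter.atTop (nhds (αs + (0 : ℝ) • e)) :=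
      tendsto_const_nhds.add (ht0.smul_const e)
    simpa using this
  -- unit eigenvectors
  have hex : ∀ n, ∃ g : V → ℂ, g ∈ Metric.sphere (0 : V → ℂ) 1 ∧
      (magH G q v u (a n)) *ᵥ g = (lam (a n) : ℂ) • g := by
    intro n
    obtain ⟨g, hg⟩ := (hlam (a n)).exists_hasEigenvector
    have h1 := hg.apply_eq_smul
    have hn : (‖g‖ : ℂ) ≠ 0 := by exact_mod_cast norm_ne_zero_iff.mpr hg.2
    refine ⟨((‖g‖ : ℂ)⁻¹) • g, ?_, ?_⟩
    · have : ‖g‖ ≠ 0 := norm_ne_zero_iff.mpr hg.2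
      simp [norm_smul, this]
    · rw [Matrix.mulVec_smul]
      rw [Matrix.mulVecLin_apply] at h1
      rw [h1, smul_comm]
  choose g hgs hge using hex
  obtain ⟨g0, hg0, φ, hφ, hlim⟩ := (isCompact_sphere (0 : V → ℂ) 1).tendsto_subseq hgs
  have hφt := hφ.tendsto_atTop
  have haφ := ha0.comp hφt
  have htφ : Filter.Tendsto (t ∘ φ) Filter.atTop (nhdsWithin 0 {0}ᶜ) :=
    tendsto_nhdsWithin_iff.mpr ⟨ht0.comp hφt, Filter.Eventually.of_forall fun n => htpos _⟩
  -- the limit is an eigenvector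
  have hg0e : (magH G q v u αs) *ᵥ g0 = (lam αs : ℂ) • g0 := by
    have hc : Continuous (fun p : (Fin k → ℝ) × (V → ℂ) => magH G q v u p.1 *ᵥ p.2) :=
      ((magH_cont G q v u).comp continuous_fst).matrix_mulVec continuous_snd
    have h1 := (hc.tendsto (αs, g0)).comp (haφ.prodMk_nhds hlim)
    have h2 : Filter.Tendsto (fun n => (lam (a (φ n)) : ℂ) • g (φ n)) Filter.atTop
        (nhds ((lam αs : ℂ) • g0)) :=
      ((Complex.continuous_ofReal.tendsto _).comp
        (hdiff.continuousAt.tendsto.comp haφ)).smul hlim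
    refine tendsto_nhds_unique h1 (h2.congr fun n => ?_)
    exact (hge (φ n)).symm
  have hg00 : g0 ≠ 0 := by
    rintro rfl
    simp at hg0
  obtain ⟨c, hc⟩ : ∃ c : ℂ, c • f = g0 := by
    have hfm : f ∈ Module.End.eigenspace (magH G q v u αs).mulVecLin (lam αs : ℂ) := by
      rw [Module.End.mem_eigenspace_iff]; exact hf
    have hgm : g0 ∈ Module.End.eigenspace (magH G q v u αs).mulVecLin (lam αs : ℂ) := by
      rw [Module.End.mem_eigenspace_iff]; exact hg0e
    obtain ⟨c, hc⟩ := exists_smul_eq_of_finrank_eq_one hsimple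
      (x := ⟨f, hfm⟩) (by simpa [Subtype.ext_iff] using hf0) ⟨g0, hgm⟩
    exact ⟨c, by simpa [Subtype.ext_iff] using hc⟩
  have hc0 : c ≠ 0 := by
    rintro rfl
    exact hg00 (by simpa using hc.symm)
  -- key identity
  have key : ∀ n, ((lam (a n) : ℂ) - lam αs) * (star f ⬝ᵥ g n) =
      -((Complex.exp (Complex.I * ((αs j + t n : ℝ) : ℂ)) - Complex.exp (Complex.I * αs j))
          * g n (u j) * star (f (v j)) +
        (Complex.exp (-(Complex.I * ((αs j + t n : ℝ) : ℂ)))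
          - Complex.exp (-(Complex.I * αs j))) * g n (v j) * star (f (u j))) := by
    intro n
    have h1 : star f ⬝ᵥ (magH G q v u (a n) *ᵥ g n) = (lam (a n) : ℂ) * (star f ⬝ᵥ g n) := by
      rw [hge, dotProduct_smul, smul_eq_mul]
    have h2 : star f ⬝ᵥ (magH G q v u αs *ᵥ g n) = (lam αs : ℂ) * (star f ⬝ᵥ g n) := by
      have h3 : star f ᵥ* magH G q v u αs = (lam αs : ℂ) • star f := by
        have := congrArg star hf
        rw [Matrix.star_mulVec, (magH_herm G q v u αs).eq] at this
        rw [this, star_smul]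
        simp
      rw [Matrix.dotProduct_mulVec, h3, smul_dotProduct, smul_eq_mul]
    rw [sub_mul, ← h1, ← h2, ← dotProduct_sub, ← Matrix.sub_mulVec]
    have h4 : magH G q v u (a n) - magH G q v u αs = magM v u αs - magM v u (a n) := by
      simp only [magH]; abel
    rw [h4, Matrix.sub_mulVec, dotProduct_sub, magM_form, magM_form, ← Finset.sum_sub_distrib,
      Finset.sum_eq_single j]
    · have : a n j = αs j + t n := by simp [ha, he]
      rw [this]; ring
    · intro i _ hi
      have : a n i = αs i := by simp [ha, he, hi]
      rw [this]; ring
    · simp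
  -- derivatives
  have hd0 : HasDerivAt (fun s : ℝ => lam (αs + s • e)) 0 0 := by
    have := hdiff.hasFDerivAt.hasLineDerivAt e
    rw [hcrit] at this
    simpa [HasLineDerivAt] using this
  have hdl : HasDerivAt (fun s : ℝ => (lam (αs + s • e) : ℂ)) 0 0 := by
    simpa using hd0.ofReal_comp
  have hlin : HasDerivAt (fun s : ℝ => Complex.I * ((αs j + s : ℝ) : ℂ)) Complex.I 0 := by
    have h : HasDerivAt (fun s : ℝ => αs j + s) 1 0 := (hasDerivAt_id (0 : ℝ)).const_add _
    simpa using h.ofReal_comp.const_mul Complex.I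
  have hd1 : HasDerivAt (fun s : ℝ => Complex.exp (Complex.I * ((αs j + s : ℝ) : ℂ)))
      (Complex.exp (Complex.I * αs j) * Complex.I) 0 := by
    simpa using hlin.cexp
  have hd2 : HasDerivAt (fun s : ℝ => Complex.exp (-(Complex.I * ((αs j + s : ℝ) : ℂ))))
      (-(Complex.exp (-(Complex.I * αs j)) * Complex.I)) 0 := by
    simpa using hlin.fun_neg.cexp
  have l0 := hdl.tendsto_slope_zero.comp htφ
  have l1 := hd1.tendsto_slope_zero.comp htφ
  have l2 := hd2.tendsto_slope_zero.comp htφ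
  have hgc : ∀ x, Filter.Tendsto (fun n => g (φ n) x) Filter.atTop (nhds (g0 x)) :=
    fun x => (tendsto_pi_nhds.mp hlim) x
  have hdot : Filter.Tendsto (fun n => star f ⬝ᵥ g (φ n)) Filter.atTop (nhds (star f ⬝ᵥ g0)) := by
    simp only [dotProduct]
    exact tendsto_finsetSum _ fun x _ => (hgc x).const_mul _
  have L := l0.mul hdot
  have R := (((l1.mul (hgc (u j))).mul_const (star (f (v j)))).add
    ((l2.mul (hgc (v j))).mul_const (star (f (u j))))).neg
  have E := tendsto_nhds_unique L (R.congr fun n => by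
    have := key (φ n)
    simp only [Function.comp, zero_add, add_zero, zero_smul, Complex.real_smul]
    linear_combination (-((t (φ n))⁻¹ : ℝ) : ℂ) * this)
  rw [← hc] at E
  simp only [Pi.smul_apply, smul_eq_mul, zero_mul] at E
  set z : ℂ := Complex.exp (Complex.I * αs j) * f (u j) * (starRingEnd ℂ) (f (v j)) with hz
  have hzc : (starRingEnd ℂ) z =
      Complex.exp (-(Complex.I * αs j)) * star (f (u j)) * f (v j) := by
    simp [hz, ← Complex.exp_conj]
  have E2 : c * Complex.I * (z - (starRingEnd ℂ) z) = 0 := by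
    rw [hzc, hz, ← Complex.star_def]
    linear_combination E
  have E3 : z - (starRingEnd ℂ) z = 0 :=
    (mul_eq_zero.mp E2).resolve_left (mul_ne_zero hc0 Complex.I_ne_zero)
  exact Complex.conj_eq_iff_im.mp (sub_eq_zero.mp E3).symm
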